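/- Let n ≥ 3, Ω ⊂ ℝⁿ open with K = ℝⁿ \ Ω compact and Cap₂(K, ℝⁿ) = 0, and let ρ ∈ C²(Ω) be positive with Δρ ≤ 0 on Ω. Then for every u ∈ C_0^∞(ℝⁿ): ∫_Ω (u²/ρ²)|∇ρ|² dx ≤ 4 ∫_Ω |∇u|² dx. -/

import Mathlib

open MeasureTheory ENNReal

noncomputable def lap {n : ℕ} (f : EuclideanSpace ℝ (Fin n) → ℝ)
    (x : EuclideanSpace ℝ (Fin n)) : ℝ :=
  ∑ i, fderiv ℝ (fun y => fderiv ℝ f y (EuclideanSpace.single i 1)) x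
      (EuclideanSpace.single i 1)

/-- The 2-capacity of a compact set `K` in `ℝⁿ`, defined via Dirichlet energies of
smooth compactly supported test functions with `0 ≤ u ≤ 1` that equal `1` on a
neighborhood of `K`. -/
noncomputable def cap2 {n : ℕ} (K : Set (EuclideanSpace ℝ (Fin n))) : ℝ≥0∞ :=
  ⨅ u ∈ {u : EuclideanSpace ℝ (Fin n) → ℝ |
      ContDiff ℝ (⊤ : ℕ∞) u ∧ HasCompactSupport u ∧ (∀ x, 0 ≤ u x ∧ u x ≤ 1) ∧
        ∃ U : Set (EuclideanSpace ℝ (Fin n)), IsOpen U ∧ K ⊆ U ∧ ∀ x ∈ U, u x = 1},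
    ∫⁻ x, ENNReal.ofReal (‖gradient u x‖ ^ 2)

open Filter Topology

lemma grad_sq {n : ℕ} (f : EuclideanSpace ℝ (Fin n) → ℝ) (x : EuclideanSpace ℝ (Fin n)) :
    ‖gradient f x‖ ^ 2 = ∑ i, (fderiv ℝ f x (EuclideanSpace.single i 1)) ^ 2 := by
  rw [EuclideanSpace.real_norm_sq_eq]
  refine Finset.sum_congr rfl fun i _ => ?_
  have := inner_gradient_left (𝕜 := ℝ) (f := f) (x := x) (y := EuclideanSpace.single i (1:ℝ))
  rw [← this, EuclideanSpace.inner_single_right]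
  simp

lemma grad_norm {n : ℕ} (f : EuclideanSpace ℝ (Fin n) → ℝ) (x : EuclideanSpace ℝ (Fin n)) :
    ‖gradient f x‖ = ‖fderiv ℝ f x‖ := by
  simp [gradient]

lemma int_div_zero {n : ℕ} (F : EuclideanSpace ℝ (Fin n) → ℝ) (hF : ContDiff ℝ 1 F)
    (hc : HasCompactSupport F) (e : EuclideanSpace ℝ (Fin n)) :
    Integrable (fun x => fderiv ℝ F x e) ∧ ∫ x, fderiv ℝ F x e = 0 := by
  have hi : Integrable (fun x => fderiv ℝ F x e) := by
    apply Continuous.integrable_of_hasCompactSupport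
    · exact (hF.continuous_fderiv (by norm_num)).clm_apply continuous_const
    · exact (hc.fderiv (𝕜 := ℝ)).comp_left (g := fun L : EuclideanSpace ℝ (Fin n) →L[ℝ] ℝ => L e) (by simp)
  refine ⟨hi, ?_⟩
  have := integral_mul_fderiv_eq_neg_fderiv_mul_of_integrable (μ := volume) (f := fun _ => (1:ℝ))
    (g := F) (v := e) (by simp) (by simpa using hi)
    (by simpa using hF.continuous.integrable_of_hasCompactSupport hc)
    (fun x _ => by fun_prop) (fun x _ => hF.differentiable (by norm_num) x)
  simpa using this

lemma contDiff_of_supp {n : ℕ} {k : WithTop ℕ∞} {Ω : Set (EuclideanSpace ℝ (Fin n))} (hΩ : IsOpen Ω)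
    {F v : EuclideanSpace ℝ (Fin n) → ℝ} (hvΩ : tsupport v ⊆ Ω)
    (hF : ContDiffOn ℝ k F Ω) (h0 : ∀ x, v x = 0 → F x = 0) : ContDiff ℝ k F := by
  rw [contDiff_iff_contDiffAt]
  intro x
  by_cases hx : x ∈ Ω
  · exact hF.contDiffAt (hΩ.mem_nhds hx)
  · have hx' : x ∉ tsupport v := fun h => hx (hvΩ h)
    have : F =ᶠ[𝓝 x] fun _ => 0 := by
      filter_upwards [(isClosed_tsupport v).isOpen_compl.mem_nhds hx'] with y hy
      exact h0 y (image_eq_zero_of_notMem_tsupport hy)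
    exact contDiffAt_const.congr_of_eventuallyEq this

lemma cs_of_supp {n : ℕ} 
    {F v : EuclideanSpace ℝ (Fin n) → ℝ} (hc : HasCompactSupport v)
    (h0 : ∀ x, v x = 0 → F x = 0) : HasCompactSupport F := by
  apply hc.mono
  intro x hx hv
  exact hx (h0 x hv)

lemma cs_grad_sq {n : ℕ} {v : EuclideanSpace ℝ (Fin n) → ℝ} (hv : ContDiff ℝ 1 v)
    (hc : HasCompactSupport v) : Integrable (fun x => ‖gradient v x‖ ^ 2) := by
  simp_rw [grad_norm]
  apply Continuous.integrable_of_hasCompactSupport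
  · exact ((hv.continuous_fderiv (by norm_num)).norm.pow 2)
  · exact (hc.fderiv (𝕜 := ℝ)).comp_left (g := fun L : EuclideanSpace ℝ (Fin n) →L[ℝ] ℝ => ‖L‖^2) (by simp)

lemma hardy_cs {n : ℕ} 
    (Ω : Set (EuclideanSpace ℝ (Fin n))) (hΩ : IsOpen Ω)
    (ρ : EuclideanSpace ℝ (Fin n) → ℝ)
    (hρC2 : ContDiffOn ℝ 2 ρ Ω) (hρpos : ∀ x ∈ Ω, 0 < ρ x)
    (hsuper : ∀ x ∈ Ω, lap ρ x ≤ 0)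
    (v : EuclideanSpace ℝ (Fin n) → ℝ)
    (hv : ContDiff ℝ 1 v) (hc : HasCompactSupport v) (hvΩ : tsupport v ⊆ Ω) :
    Integrable (fun x => (v x) ^ 2 / (ρ x) ^ 2 * ‖gradient ρ x‖ ^ 2) ∧ 
    ∫ x, (v x) ^ 2 / (ρ x) ^ 2 * ‖gradient ρ x‖ ^ 2 ≤ 4 * ∫ x, ‖gradient v x‖ ^ 2 := by
  have hd : ContDiffOn ℝ 1 (fderiv ℝ ρ) Ω := hρC2.fderiv_of_isOpen hΩ (by norm_num)
  have hρ1 : ContDiffOn ℝ 1 ρ Ω := hρC2.of_le (by norm_num)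
  have hne : ∀ x ∈ Ω, ρ x ≠ 0 := fun x hx => (hρpos x hx).ne'
  let F : Fin n → EuclideanSpace ℝ (Fin n) → ℝ := fun i x =>
    v x ^ 2 / ρ x * fderiv ℝ ρ x (EuclideanSpace.single i 1)
  have hF0 : ∀ i x, v x = 0 → F i x = 0 := by intro i x h; simp [F, h]
  have hdi : ∀ i : Fin n, ContDiffOn ℝ 1 (fun x => fderiv ℝ ρ x (EuclideanSpace.single i 1)) Ω :=
    fun i => hd.clm_apply contDiffOn_const
  have hF : ∀ i, ContDiff ℝ 1 (F i) := fun i => contDiff_of_supp hΩ hvΩ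
    (((hv.contDiffOn.pow 2).div hρ1 hne).mul (hdi i)) (hF0 i)
  have hFc : ∀ i, HasCompactSupport (F i) := fun i => cs_of_supp hc (hF0 i)
  have hA : Integrable (fun x => (v x) ^ 2 / (ρ x) ^ 2 * ‖gradient ρ x‖ ^ 2) := by
    apply Continuous.integrable_of_hasCompactSupport
    · have : ContDiff ℝ 0 (fun x => (v x) ^ 2 / (ρ x) ^ 2 * ‖gradient ρ x‖ ^ 2) := by
        apply contDiff_of_supp hΩ hvΩ
        · simp_rw [grad_norm]
          rw [contDiffOn_zero]
          exact ((hv.continuous.continuousOn.pow 2).div (hρ1.continuousOn.pow 2)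
            (fun x hx => pow_ne_zero 2 (hne x hx))).mul (hd.continuousOn.norm.pow 2)
        · intro x h; simp [h]
      exact this.continuous
    · apply cs_of_supp hc
      intro x h; simp [h]
  refine ⟨hA, ?_⟩
  have key : ∀ x, (v x) ^ 2 / (ρ x) ^ 2 * ‖gradient ρ x‖ ^ 2 ≤
      4 * ‖gradient v x‖ ^ 2 - 2 * ∑ i, fderiv ℝ (F i) x (EuclideanSpace.single i 1) := by
    intro x
    by_cases hx : x ∈ Ω
    · have hρd : DifferentiableAt ℝ ρ x := 
        (hρ1.contDiffAt (hΩ.mem_nhds hx)).differentiableAt (by norm_num)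
      have hvd : DifferentiableAt ℝ v x := hv.differentiable (by norm_num) x
      have h0 := hne x hx
      have hp := hρpos x hx
      have e : ∀ i, fderiv ℝ (F i) x (EuclideanSpace.single i 1) =
          2 * v x * fderiv ℝ v x (EuclideanSpace.single i 1)
            * fderiv ℝ ρ x (EuclideanSpace.single i 1) / ρ x
          - v x ^ 2 / ρ x ^ 2 * (fderiv ℝ ρ x (EuclideanSpace.single i 1)) ^ 2
          + v x ^ 2 / ρ x * fderiv ℝ (fun y => fderiv ℝ ρ y (EuclideanSpace.single i 1)) x
            (EuclideanSpace.single i 1) := by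
        intro i
        have hdd : DifferentiableAt ℝ (fun y => fderiv ℝ ρ y (EuclideanSpace.single i 1)) x :=
          ((hdi i).contDiffAt (hΩ.mem_nhds hx)).differentiableAt (by norm_num)
        have h1 := ((hvd.hasFDerivAt.pow 2).mul
          ((hasDerivAt_inv h0).comp_hasFDerivAt x hρd.hasFDerivAt)).mul hdd.hasFDerivAt
        have h2 : HasFDerivAt (F i) _ x := h1
        rw [h2.fderiv]
        simp
        field_simp
        ring
      simp_rw [e]
      rw [grad_sq, grad_sq]
      have hl := hsuper x hx
      unfold lap at hl
      have hl2 : v x ^ 2 / ρ x * ∑ i, fderiv ℝ (fun y => fderiv ℝ ρ y (EuclideanSpace.single i 1)) x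
            (EuclideanSpace.single i 1) ≤ 0 := 
        mul_nonpos_of_nonneg_of_nonpos (by positivity) hl
      rw [Finset.mul_sum] at hl2
      rw [Finset.sum_add_distrib]
      have h3 : v x ^ 2 / ρ x ^ 2 * ∑ i, (fderiv ℝ ρ x (EuclideanSpace.single i 1)) ^ 2 ≤
        4 * ∑ i, (fderiv ℝ v x (EuclideanSpace.single i 1)) ^ 2 -
        2 * ∑ i, (2 * v x * fderiv ℝ v x (EuclideanSpace.single i 1)
            * fderiv ℝ ρ x (EuclideanSpace.single i 1) / ρ x
          - v x ^ 2 / ρ x ^ 2 * (fderiv ℝ ρ x (EuclideanSpace.single i 1)) ^ 2) := by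
        rw [Finset.mul_sum, Finset.mul_sum, Finset.mul_sum, ← Finset.sum_sub_distrib]
        apply Finset.sum_le_sum
        intro i _
        have := sq_nonneg (v x * fderiv ℝ ρ x (EuclideanSpace.single i 1) / ρ x
          - 2 * fderiv ℝ v x (EuclideanSpace.single i 1))
        ring_nf at this ⊢
        linarith
      linarith
    · have hx' : x ∉ tsupport v := fun h => hx (hvΩ h)
      have hn : ∀ᶠ y in 𝓝 x, v y = 0 := by
        filter_upwards [(isClosed_tsupport v).isOpen_compl.mem_nhds hx'] with y hy
        exact image_eq_zero_of_notMem_tsupport hy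
      have e : ∀ i, fderiv ℝ (F i) x = 0 := by
        intro i
        have : F i =ᶠ[𝓝 x] fun _ => 0 := by
          filter_upwards [hn] with y hy
          exact hF0 i y hy
        rw [this.fderiv_eq]; simp
      simp [e, hn.self_of_nhds]
  have hs : Integrable (fun x => ∑ i, fderiv ℝ (F i) x (EuclideanSpace.single i 1)) :=
    integrable_finsetSum _ fun i _ => (int_div_zero (F i) (hF i) (hFc i) _).1
  have hs0 : ∫ x, ∑ i, fderiv ℝ (F i) x (EuclideanSpace.single i 1) = 0 := by
    rw [integral_finsetSum _ fun i _ => (int_div_zero (F i) (hF i) (hFc i) _).1]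
    exact Finset.sum_eq_zero fun i _ => (int_div_zero (F i) (hF i) (hFc i) _).2
  have hg := cs_grad_sq hv hc
  calc _ ≤ ∫ x, (4 * ‖gradient v x‖ ^ 2 - 
          2 * ∑ i, fderiv ℝ (F i) x (EuclideanSpace.single i 1)) :=
        integral_mono hA ((hg.const_mul 4).sub (hs.const_mul 2)) key
    _ = _ := by
        rw [integral_sub (hg.const_mul 4) (hs.const_mul 2), integral_const_mul, 
          integral_const_mul, hs0]
        ring

lemma cap_seq {n : ℕ} {K : Set (EuclideanSpace ℝ (Fin n))} (hcap : cap2 K = 0)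
    {δ : ℝ≥0∞} (hδ : 0 < δ) : ∃ η : EuclideanSpace ℝ (Fin n) → ℝ,
      (ContDiff ℝ (⊤ : ℕ∞) η ∧ HasCompactSupport η ∧ (∀ x, 0 ≤ η x ∧ η x ≤ 1) ∧
        ∃ U : Set (EuclideanSpace ℝ (Fin n)), IsOpen U ∧ K ⊆ U ∧ ∀ x ∈ U, η x = 1) ∧
      ∫⁻ x, ENNReal.ofReal (‖gradient η x‖ ^ 2) < δ := by
  rw [← hcap] at hδ
  unfold cap2 at hδ
  simp only [iInf_lt_iff] at hδ
  obtain ⟨η, h1, h2⟩ := hδ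
  exact ⟨η, h1, h2⟩

lemma ae_zero {n : ℕ} (hn : 3 ≤ n) (η : ℕ → EuclideanSpace ℝ (Fin n) → ℝ)
    (hη : ∀ k, ContDiff ℝ 1 (η k)) (hc : ∀ k, HasCompactSupport (η k))
    (hE : Tendsto (fun k => ∫⁻ x, ENNReal.ofReal (‖gradient (η k) x‖ ^ 2)) atTop (𝓝 0)) :
    ∃ ns : ℕ → ℕ, StrictMono ns ∧ ∀ᵐ x, Tendsto (fun i => η (ns i) x) atTop (𝓝 0) := by
  have hn' : (3:ℝ) ≤ n := by exact_mod_cast hn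
  have hpos : (0:ℝ) < 2⁻¹ - (n:ℝ)⁻¹ := by
    rw [sub_pos]
    exact inv_strictAnti₀ (by norm_num) (by linarith)
  let p' : NNReal := ⟨(2⁻¹ - (n:ℝ)⁻¹)⁻¹, by positivity⟩
  have hp' : (p' : ℝ) = (2⁻¹ - (n:ℝ)⁻¹)⁻¹ := rfl
  have hp0 : p' ≠ 0 := by
    intro h
    have : (p' : ℝ) = 0 := by rw [h]; simp
    rw [hp'] at this
    exact (inv_pos.2 hpos).ne' this
  have hS : ∀ k, eLpNorm (η k) p' volume ≤ 
      (eLpNormLESNormFDerivOfEqInnerConst (volume : Measure (EuclideanSpace ℝ (Fin n))) 2 : ℝ≥0∞) *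
        (∫⁻ x, ENNReal.ofReal (‖gradient (η k) x‖ ^ 2)) ^ (2⁻¹ : ℝ) := by
    intro k
    have := eLpNorm_le_eLpNorm_fderiv_of_eq_inner volume (hη k) (hc k) (p := 2) (p' := p')
      (by norm_num) (by simp; omega) (by rw [hp']; simp)
    refine this.trans_eq ?_
    rw [eLpNorm_nnreal_eq_lintegral (by norm_num)]
    congr 2
    · refine lintegral_congr fun x => ?_
      rw [grad_norm, ENNReal.ofReal_pow (norm_nonneg _), ofReal_norm]
      simp
    · simp
  have hT : Tendsto (fun k => eLpNorm (η k) p' volume) atTop (𝓝 0) := by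
    refine tendsto_of_tendsto_of_tendsto_of_le_of_le tendsto_const_nhds ?_ (fun _ => zero_le) hS
    have h1 := (ENNReal.continuous_rpow_const (y := (2⁻¹:ℝ))).tendsto 0 |>.comp hE
    rw [ENNReal.zero_rpow_of_pos (by norm_num)] at h1
    have h2 := ENNReal.Tendsto.const_mul h1 (a := (eLpNormLESNormFDerivOfEqInnerConst (volume : Measure (EuclideanSpace ℝ (Fin n))) 2 : ℝ≥0∞)) (Or.inr (by simp))
    simpa using h2
  have hM : TendstoInMeasure volume η atTop (fun _ => 0) := by
    refine tendstoInMeasure_of_tendsto_eLpNorm (p := p') (by exact_mod_cast hp0)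
      (fun k => (hη k).continuous.aestronglyMeasurable) aestronglyMeasurable_const ?_
    refine hT.congr fun k => ?_
    congr 1
    ext x; simp
  exact hM.exists_seq_tendsto_ae

lemma cutoff_bound {n : ℕ} 
    (Ω : Set (EuclideanSpace ℝ (Fin n))) (hΩ : IsOpen Ω)
    (ρ : EuclideanSpace ℝ (Fin n) → ℝ)
    (hρC2 : ContDiffOn ℝ 2 ρ Ω) (hρpos : ∀ x ∈ Ω, 0 < ρ x)
    (hsuper : ∀ x ∈ Ω, lap ρ x ≤ 0)
    (u : EuclideanSpace ℝ (Fin n) → ℝ)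
    (hu : ContDiff ℝ 1 u) (hcs : HasCompactSupport u) 
    (M : ℝ) (hM : ∀ x, |u x| ≤ M)
    (η : EuclideanSpace ℝ (Fin n) → ℝ) (hη : ContDiff ℝ 1 η) (hηc : HasCompactSupport η)
    (h01 : ∀ x, 0 ≤ η x ∧ η x ≤ 1) (U : Set (EuclideanSpace ℝ (Fin n))) (hU : IsOpen U)
    (hKU : Ωᶜ ⊆ U) (hU1 : ∀ x ∈ U, η x = 1) (δ : ℝ) (hδ : 0 < δ)
    (hE : ∫⁻ x, ENNReal.ofReal (‖gradient η x‖ ^ 2) < ENNReal.ofReal (δ ^ 2)) :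
    ∫⁻ x in Ω, ENNReal.ofReal ((u x * (1 - η x)) ^ 2 / (ρ x) ^ 2 * ‖gradient ρ x‖ ^ 2) ≤
      ENNReal.ofReal (4 * ((1 + δ) * (∫ x in Ω, ‖gradient u x‖ ^ 2) + (δ ^ 2 + δ) * M ^ 2)) := by
  let v : EuclideanSpace ℝ (Fin n) → ℝ := fun x => u x * (1 - η x)
  have hv : ContDiff ℝ 1 v := hu.mul (contDiff_const.sub hη)
  have hvc : HasCompactSupport v := hcs.mul_right
  have hvΩ : tsupport v ⊆ Ω := by
    intro x hx
    by_contra hxΩ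
    have hxU : x ∈ U := hKU hxΩ
    have : tsupport v ⊆ Uᶜ := by
      apply closure_minimal _ hU.isClosed_compl
      intro y hy hyU
      apply hy
      simp [v, hU1 y hyU]
    exact this hx hxU
  obtain ⟨hA, hB⟩ := hardy_cs Ω hΩ ρ hρC2 hρpos hsuper v hv hvc hvΩ
  have hη2 := cs_grad_sq hη hηc
  have hu2 := cs_grad_sq hu hcs
  have hv2 := cs_grad_sq hv hvc
  have hEr : ∫ x, ‖gradient η x‖ ^ 2 ≤ δ ^ 2 := by
    rw [← ofReal_integral_eq_lintegral_ofReal hη2 (ae_of_all _ fun x => by positivity)] at hE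
    exact ((ENNReal.ofReal_lt_ofReal_iff (by positivity)).1 hE).le
  have hpt : ∀ x, ‖gradient v x‖ ^ 2 ≤ Ω.indicator (fun x => (1 + δ) * ‖gradient u x‖ ^ 2) x +
      (1 + δ⁻¹) * M ^ 2 * ‖gradient η x‖ ^ 2 := by
    intro x
    by_cases hx : x ∈ Ω
    · rw [Set.indicator_of_mem hx]
      have hd : fderiv ℝ v x = u x • (- fderiv ℝ η x) + (1 - η x) • fderiv ℝ u x := by
        have h1 := (hu.differentiable (by norm_num) x).hasFDerivAt.mul
          ((hη.differentiable (by norm_num) x).hasFDerivAt.const_sub 1)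
        exact h1.fderiv
      have hle : ‖gradient v x‖ ≤ M * ‖gradient η x‖ + ‖gradient u x‖ := by
        simp only [grad_norm]
        rw [hd]
        refine (norm_add_le _ _).trans ?_
        rw [norm_smul, norm_smul, norm_neg, Real.norm_eq_abs, Real.norm_eq_abs]
        have : |1 - η x| ≤ 1 := by
          rw [abs_le]; constructor <;> linarith [(h01 x).1, (h01 x).2]
        have h3 := mul_le_mul_of_nonneg_right this (norm_nonneg (fderiv ℝ u x))
        have h4 := mul_le_mul_of_nonneg_right (hM x) (norm_nonneg (fderiv ℝ η x))
        linarith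
      generalize ‖gradient η x‖ = a at *
      have hb := norm_nonneg (gradient v x)
      generalize ‖gradient u x‖ = b at *
      have h5 : ‖gradient v x‖ ^ 2 ≤ (M * a + b) ^ 2 := by gcongr
      refine h5.trans ?_
      have h6 : (1 + δ) * b ^ 2 + (1 + δ⁻¹) * M ^ 2 * a ^ 2 - (M * a + b) ^ 2
          = δ⁻¹ * (δ * b - M * a) ^ 2 := by
        field_simp; ring
      have h7 : 0 ≤ δ⁻¹ * (δ * b - M * a) ^ 2 := by positivity
      linarith
    · have hx' : x ∉ tsupport v := fun h => hx (hvΩ h)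
      have hg : gradient v x = 0 := by
        have : v =ᶠ[𝓝 x] fun _ => 0 := notMem_tsupport_iff_eventuallyEq.1 hx'
        rw [this.gradient_eq]; simp
      rw [hg, Set.indicator_of_notMem hx]
      have : 0 ≤ (1 + δ⁻¹) * M ^ 2 * ‖gradient η x‖ ^ 2 := by positivity
      simpa using this
  have hint : ∫ x, ‖gradient v x‖ ^ 2 ≤ 
      (1 + δ) * (∫ x in Ω, ‖gradient u x‖ ^ 2) + (δ ^ 2 + δ) * M ^ 2 := by
    have i1 : Integrable (Ω.indicator (fun x => (1 + δ) * ‖gradient u x‖ ^ 2)) :=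
      (hu2.const_mul _).indicator hΩ.measurableSet
    have i2 := hη2.const_mul ((1 + δ⁻¹) * M ^ 2)
    calc _ ≤ _ := integral_mono hv2 (i1.add i2) hpt
      _ = (1 + δ) * (∫ x in Ω, ‖gradient u x‖ ^ 2) + 
        ((1 + δ⁻¹) * M ^ 2) * ∫ x, ‖gradient η x‖ ^ 2 := by
          simp only [Pi.add_apply]
          rw [integral_add i1 i2, integral_indicator hΩ.measurableSet, integral_const_mul,
            integral_const_mul]
      _ ≤ (1 + δ) * (∫ x in Ω, ‖gradient u x‖ ^ 2) + ((1 + δ⁻¹) * M ^ 2) * δ ^ 2 := by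
          gcongr
      _ = _ := by field_simp
  calc _ ≤ ∫⁻ x, ENNReal.ofReal ((v x) ^ 2 / (ρ x) ^ 2 * ‖gradient ρ x‖ ^ 2) :=
        setLIntegral_le_lintegral _ _
    _ = ENNReal.ofReal (∫ x, (v x) ^ 2 / (ρ x) ^ 2 * ‖gradient ρ x‖ ^ 2) :=
        (ofReal_integral_eq_lintegral_ofReal hA (ae_of_all _ fun x => by positivity)).symm
    _ ≤ _ := by
        apply ENNReal.ofReal_le_ofReal
        linarith

theorem hardy_extended_null_capacity (n : ℕ) (hn : 3 ≤ n)
    (Ω : Set (EuclideanSpace ℝ (Fin n))) (hΩ : IsOpen Ω)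
    (hKcpt : IsCompact Ωᶜ) (hcap : cap2 Ωᶜ = 0)
    (ρ : EuclideanSpace ℝ (Fin n) → ℝ)
    (hρC2 : ContDiffOn ℝ 2 ρ Ω) (hρpos : ∀ x ∈ Ω, 0 < ρ x)
    (hsuper : ∀ x ∈ Ω, lap ρ x ≤ 0)
    (u : EuclideanSpace ℝ (Fin n) → ℝ)
    (hu : ContDiff ℝ (⊤ : ℕ∞) u) (hcs : HasCompactSupport u) :
    ∫ x in Ω, (u x) ^ 2 / (ρ x) ^ 2 * ‖gradient ρ x‖ ^ 2
      ≤ 4 * ∫ x in Ω, ‖gradient u x‖ ^ 2 := by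
  have hu1 : ContDiff ℝ 1 u := hu.of_le (by exact_mod_cast le_top)
  obtain ⟨M, hM⟩ : ∃ M : ℝ, ∀ x, |u x| ≤ M := by
    obtain ⟨M, hM⟩ := hcs.exists_bound_of_continuous hu.continuous
    exact ⟨M, fun x => by simpa using hM x⟩
  let δ : ℕ → ℝ := fun k => 1 / ((k : ℝ) + 1)
  have hδ : ∀ k, 0 < δ k := fun k => by simp only [δ]; positivity
  have hδ0 : Tendsto δ atTop (𝓝 0) := tendsto_one_div_add_atTop_nhds_zero_nat
  have hex := fun k => cap_seq hcap (δ := ENNReal.ofReal (δ k ^ 2))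
    (ENNReal.ofReal_pos.2 (pow_pos (hδ k) 2))
  choose η hη hE using hex
  have hη1 : ∀ k, ContDiff ℝ 1 (η k) := fun k => (hη k).1.of_le (by exact_mod_cast le_top)
  have hE0 : Tendsto (fun k => ∫⁻ x, ENNReal.ofReal (‖gradient (η k) x‖ ^ 2)) atTop (𝓝 0) := by
    refine tendsto_of_tendsto_of_tendsto_of_le_of_le tendsto_const_nhds ?_ (fun _ => zero_le)
      (fun k => (hE k).le)
    have := ENNReal.tendsto_ofReal (hδ0.pow 2)
    simpa using this
  obtain ⟨ns, hns, hae⟩ := ae_zero hn η hη1 (fun k => (hη k).2.1) hE0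
  set I := ∫ x in Ω, ‖gradient u x‖ ^ 2 with hI
  have hI0 : 0 ≤ I := integral_nonneg fun x => by positivity
  have hcρ : ContinuousOn (fun x => ‖gradient ρ x‖ ^ 2) Ω := by
    simp_rw [grad_norm]
    exact (hρC2.continuousOn_fderiv_of_isOpen hΩ (by norm_num)).norm.pow 2
  have hmeas : ∀ w : EuclideanSpace ℝ (Fin n) → ℝ, Continuous w →
      AEStronglyMeasurable (fun x => (w x) ^ 2 / (ρ x) ^ 2 * ‖gradient ρ x‖ ^ 2)
        (volume.restrict Ω) := by
    intro w hw
    refine ContinuousOn.aestronglyMeasurable ?_ hΩ.measurableSet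
    exact ((hw.continuousOn.pow 2).div (hρC2.continuousOn.pow 2)
            (fun x hx => pow_ne_zero 2 (hρpos x hx).ne')).mul hcρ
  let a : ℕ → EuclideanSpace ℝ (Fin n) → ℝ≥0∞ := fun k x =>
    ENNReal.ofReal ((u x * (1 - η (ns k) x)) ^ 2 / (ρ x) ^ 2 * ‖gradient ρ x‖ ^ 2)
  have hbound : ∀ k, ∫⁻ x in Ω, a k x ≤ ENNReal.ofReal
      (4 * ((1 + δ (ns k)) * I + (δ (ns k) ^ 2 + δ (ns k)) * M ^ 2)) := by
    intro k
    obtain ⟨h1, h2, h3, U, hU, hKU, hU1⟩ := hη (ns k)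
    exact cutoff_bound Ω hΩ ρ hρC2 hρpos hsuper u hu1 hcs M hM (η (ns k)) (hη1 _) h2 h3 U hU hKU
      hU1 (δ (ns k)) (hδ _) (hE _)
  have hδn := hδ0.comp hns.tendsto_atTop
  have hlim : Tendsto (fun k => ENNReal.ofReal
      (4 * ((1 + δ (ns k)) * I + (δ (ns k) ^ 2 + δ (ns k)) * M ^ 2))) atTop
      (𝓝 (ENNReal.ofReal (4 * I))) := by
    apply ENNReal.tendsto_ofReal
    have := ((((hδn.const_add 1).mul_const I).add
      (((hδn.pow 2).add hδn).mul_const (M ^ 2))).const_mul 4)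
    simpa using this
  have hfin : ∫⁻ x in Ω, ENNReal.ofReal ((u x) ^ 2 / (ρ x) ^ 2 * ‖gradient ρ x‖ ^ 2) ≤
      ENNReal.ofReal (4 * I) := by
    calc _ = ∫⁻ x in Ω, liminf (fun k => a k x) atTop := by
          apply lintegral_congr_ae
          filter_upwards [ae_restrict_of_ae hae] with x hx
          symm
          apply Tendsto.liminf_eq
          apply ENNReal.tendsto_ofReal
          have := ((((hx.const_sub 1).const_mul (u x)).pow 2).div_const (ρ x ^ 2)).mul_const
            (‖gradient ρ x‖ ^ 2)
          simpa using this
      _ ≤ liminf (fun k => ∫⁻ x in Ω, a k x) atTop := 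
          lintegral_liminf_le' fun k => (hmeas (fun x => u x * (1 - η (ns k) x))
            (hu.continuous.mul (continuous_const.sub (hη1 _).continuous))).aemeasurable.ennreal_ofReal
      _ ≤ liminf (fun k => ENNReal.ofReal
        (4 * ((1 + δ (ns k)) * I + (δ (ns k) ^ 2 + δ (ns k)) * M ^ 2))) atTop :=
          liminf_le_liminf (Eventually.of_forall hbound)
      _ = _ := hlim.liminf_eq
  rw [integral_eq_lintegral_of_nonneg_ae (ae_of_all _ fun x => by positivity)
    (hmeas u hu.continuous)]
  exact ENNReal.toReal_le_of_le_ofReal (by positivity) hfin
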